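/- Let α > −1/2, n, r, ρ ∈ ℕ₀ with 0 ≤ ρ ≤ r ≤ n, and let the generating polynomial P_n(x) = Σ_{k=0}^n a_k x^k satisfy P_n^{(r)}(x) ≥ 0 for all x ∈ [0,1]. Let [a,b] ⊆ [0,1] and let σ : [a,b] → [0,1] be any function. Then the operator L_n^{⟨α⟩}(P_n, σ, r, ρ, [a,b]; f, x) := Σ_{k=r−ρ}^{n−ρ} ((α+1)_k (k−r+ρ+1)_r / (2α+2)_k) · a_{k+ρ} · σ(x)^k · D_k^{⟨α⟩}(f,x) is positive: if f ∈ C[0,1] satisfies f ≥ 0 on [0,1], then L_n^{⟨α⟩}(P_n, σ, r, ρ, [a,b]; f, x) ≥ 0 for every x ∈ [a,b]. In particular, for r = ρ = 0, σ ≡ 1 and [a,b] = [0,1], the operator f ↦ Σ_{k=0}^n ((α+1)_k/(2α+2)_k) a_k D_k^{⟨α⟩}(f,·) is a positive linear operator. -/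

import Mathlib

noncomputable section

open Set Finset
open scoped Classical

/-- The interval `[0,1]`. -/
def I01 : Set ℝ := Set.Icc 0 1

/-- The Bernstein fundamental polynomials `p_{n,k}(x) = C(n,k) x^k (1-x)^{n-k}`. -/
def bern (n k : ℕ) (x : ℝ) : ℝ := (n.choose k : ℝ) * x ^ k * (1 - x) ^ (n - k)

/-- The Pochhammer symbol `(x)_k = x(x+1)⋯(x+k-1)`. -/
def poch (x : ℝ) (k : ℕ) : ℝ := (ascPochhammer ℝ k).eval x

/-- The Beta function `B(x,y) = ∫₀¹ t^{x-1}(1-t)^{y-1} dt`. -/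
def betaFn (x y : ℝ) : ℝ := ∫ t in (0 : ℝ)..1, t ^ (x - 1) * (1 - t) ^ (y - 1)

/-- The density of the ultraspherical weight `dw(t,α)` on `[0,1]`. -/
def wght (α t : ℝ) : ℝ := t ^ α * (1 - t) ^ α / betaFn (α + 1) (α + 1)

/-- The inner product `⟨f,g⟩ = ∫₀¹ f g dw(·,α)`. -/
def ip (α : ℝ) (f g : ℝ → ℝ) : ℝ := ∫ t in (0 : ℝ)..1, f t * g t * wght α t

/-- The Bernstein–Durrmeyer–Lupaş operator with ultraspherical weight:
`D_n^{⟨α⟩}(f,x) = Σ_k p_{n,k}(x) ⟨p_{n,k}, f⟩ / ⟨p_{n,k}, 1⟩`. -/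
def Dlup (α : ℝ) (n : ℕ) (f : ℝ → ℝ) (x : ℝ) : ℝ :=
  ∑ k ∈ Finset.range (n + 1),
    bern n k x * (ip α (bern n k) f / ip α (bern n k) (fun _ => 1))

theorem poch_succ_right (x : ℝ) (k : ℕ) : poch x (k + 1) = poch x k * (x + k) :=
  ascPochhammer_succ_eval k x

theorem poch_succ_left (x : ℝ) (k : ℕ) : poch x (k + 1) = x * poch (x + 1) k := by
  simp [poch, ascPochhammer_succ_left]

theorem poch_pos {x : ℝ} (hx : 0 < x) (k : ℕ) : 0 < poch x k :=
  ascPochhammer_pos k x hx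

theorem poch_zero (x : ℝ) : poch x 0 = 1 := by simp [poch]

theorem poch_add (x : ℝ) (k l : ℕ) : poch x (k + l) = poch x k * poch (x + k) l := by
  induction l with
  | zero => simp [poch_zero]
  | succ l ih => rw [← add_assoc, poch_succ_right, ih, poch_succ_right]; push_cast; ring

theorem poch_natCast_add_one (m r : ℕ) : poch (m + 1) r = ((m + r).descFactorial r : ℝ) := by
  have h := ascPochhammer_nat_eq_natCast_descFactorial ℝ (m + 1) r
  rw [show m + 1 + r - 1 = m + r by omega] at h
  rw [← h, poch]
  push_cast
  rfl

theorem Gamma_add_natCast {x : ℝ} (hx : 0 < x) (k : ℕ) :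
    Real.Gamma (x + k) = poch x k * Real.Gamma x := by
  induction k with
  | zero => simp [poch_zero]
  | succ k ih =>
    have hk : x + k ≠ 0 := by positivity
    rw [Nat.cast_succ, ← add_assoc, Real.Gamma_add_one hk, ih, poch_succ_right]
    ring

/-- `(1/2)_m = (2m)! / (4^m m!)`. -/
theorem poch_one_half (m : ℕ) :
    poch (1 / 2) m * 4 ^ m * (m.factorial : ℝ) = ((2 * m).factorial : ℝ) := by
  induction m with
  | zero => simp [poch_zero]
  | succ m ih =>
    rw [show 2 * (m + 1) = 2 * m + 1 + 1 by ring, Nat.factorial_succ, Nat.factorial_succ,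
      Nat.factorial_succ, poch_succ_right]
    push_cast
    rw [← ih]
    ring

/-- A form of the Chu–Vandermonde identity. -/
theorem sum_choose_mul_choose_div_poch (j l N : ℕ) (hN : j < N) {β : ℝ} (hβ : 0 < β) :
    ∑ m ∈ Finset.range N, (j.choose m : ℝ) * (l.choose m) * m.factorial / poch β m
      = poch (β + l) j / poch β j := by
  induction j generalizing l β N with
  | zero =>
    rw [Finset.sum_eq_single_of_mem 0 (Finset.mem_range.2 hN)]
    · simp [poch_zero]
    · intro m _ hm
      simp [Nat.choose_eq_zero_of_lt (Nat.pos_of_ne_zero hm)]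
  | succ j ih =>
    obtain ⟨N, rfl⟩ : ∃ M, N = M + 1 := ⟨N - 1, by omega⟩
    have split : ∑ m ∈ Finset.range (N + 1),
        ((j + 1).choose m : ℝ) * (l.choose m) * m.factorial / poch β m
        = ∑ m ∈ Finset.range (N + 1), (j.choose m : ℝ) * (l.choose m) * m.factorial / poch β m
          + ∑ m ∈ Finset.range N,
            (j.choose m : ℝ) * (l.choose (m + 1)) * (m + 1).factorial / poch β (m + 1) := by
      rw [Finset.sum_range_succ', Finset.sum_range_succ' _ N, add_right_comm,
        ← Finset.sum_add_distrib]
      congr 1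
      · refine Finset.sum_congr rfl fun m _ => ?_
        rw [Nat.choose_succ_succ]
        push_cast
        ring
      · simp
    rw [split, ih l (N + 1) (by omega) hβ]
    have hp := poch_pos hβ j
    have h1 : poch β j * (β + j) = β * poch (β + 1) j := by
      rw [← poch_succ_right, poch_succ_left]
    cases l with
    | zero =>
      simp only [Nat.choose_zero_succ, Nat.cast_zero, add_zero, mul_zero, zero_mul, zero_div,
        Finset.sum_const_zero]
      rw [div_self hp.ne', div_self (poch_pos hβ _).ne']
    | succ l =>
      have hs : ∀ m ∈ Finset.range N, (j.choose m : ℝ) * ((l + 1).choose (m + 1))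
          * (m + 1).factorial / poch β (m + 1)
          = (l + 1) / β * ((j.choose m : ℝ) * (l.choose m) * m.factorial / poch (β + 1) m) := by
        intro m _
        have hc : ((l + 1 : ℕ) : ℝ) * (l.choose m) = (l + 1).choose (m + 1) * ((m + 1 : ℕ) : ℝ) := by
          exact_mod_cast Nat.add_one_mul_choose_eq l m
        have hm := poch_pos (show 0 < β + 1 by positivity) m
        rw [poch_succ_left, Nat.factorial_succ]
        push_cast at hc ⊢
        field_simp
        linear_combination (-(j.choose m : ℝ)) * hc
      rw [Finset.sum_congr rfl hs, ← Finset.mul_sum, ih l N (by omega) (by positivity),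
        poch_succ_left β, poch_succ_right]
      have hbj : 0 < β + j := by positivity
      have : poch β j = β * poch (β + 1) j / (β + j) := by
        rw [eq_div_iff hbj.ne', h1]
      rw [this]
      push_cast
      rw [show β + 1 + (l : ℝ) = β + (l + 1) by ring]
      field_simp
      ring

/-- The polynomial `∑_j C(k,j) (β)_k / ((β)_j (β)_{k-j}) u^j v^{k-j}`, a homogeneous form of the
normalized ultraspherical polynomial of degree `k`. -/
def ultra (β : ℝ) (k : ℕ) (u v : ℝ) : ℝ :=
  ∑ j ∈ Finset.range (k + 1),
    (k.choose j : ℝ) * (poch β k / (poch β j * poch β (k - j))) * u ^ j * v ^ (k - j)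

theorem sum_range_two_mul (f : ℕ → ℝ) (N : ℕ) :
    ∑ i ∈ Finset.range (2 * N), f i = ∑ m ∈ Finset.range N, (f (2 * m) + f (2 * m + 1)) := by
  induction N with
  | zero => simp
  | succ N ih =>
    rw [show 2 * (N + 1) = 2 * N + 1 + 1 by ring, Finset.sum_range_succ, Finset.sum_range_succ, ih,
      Finset.sum_range_succ, add_assoc]

theorem add_pow_eq_sum_range_of_lt (A B : ℝ) {k N : ℕ} (hN : k < N) :
    (A + B) ^ k = ∑ i ∈ Finset.range N, (k.choose i : ℝ) * A ^ (k - i) * B ^ i := by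
  rw [add_comm, add_pow, ← Finset.sum_subset (Finset.range_subset_range.2 (Nat.succ_le_of_lt hN))]
  · exact Finset.sum_congr rfl fun i _ => by ring
  · intro i _ hi
    rw [Nat.choose_eq_zero_of_lt (by simpa using hi)]
    simp

theorem half_add_pow_add_sub_pow (A B : ℝ) (k : ℕ) :
    ((A + B) ^ k + (A - B) ^ k) / 2
      = ∑ m ∈ Finset.range (k + 1), (k.choose (2 * m) : ℝ) * A ^ (k - 2 * m) * (B ^ 2) ^ m := by
  have hk : k < 2 * (k + 1) := by omega
  rw [sub_eq_add_neg A B, add_pow_eq_sum_range_of_lt A B hk, add_pow_eq_sum_range_of_lt A (-B) hk,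
    ← Finset.sum_add_distrib, sum_range_two_mul, Finset.sum_div]
  refine Finset.sum_congr rfl fun m _ => ?_
  rw [(even_two_mul m).neg_pow, (odd_two_mul_add_one m).neg_pow, pow_mul]
  ring

theorem sum_choose_mul_pow (k m : ℕ) (u v : ℝ) :
    ∑ j ∈ Finset.range (k + 1),
      (k.choose j : ℝ) * (j.choose m) * ((k - j).choose m) * m.factorial * u ^ j * v ^ (k - j)
      = (k.choose (2 * m) : ℝ) * (u + v) ^ (k - 2 * m) * (u * v) ^ m
        * ((2 * m).factorial / m.factorial) := by
  rcases lt_or_ge k (2 * m) with h | h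
  · rw [Nat.choose_eq_zero_of_lt h]
    simp only [Nat.cast_zero, zero_mul]
    refine Finset.sum_eq_zero fun j _ => ?_
    rcases lt_or_ge j m with hj | hj
    · simp [Nat.choose_eq_zero_of_lt hj]
    · simp [Nat.choose_eq_zero_of_lt (show k - j < m by omega)]
  · obtain ⟨N, rfl⟩ := Nat.exists_eq_add_of_le h
    rw [show 2 * m + N + 1 = m + (N + 1) + m by ring, Finset.sum_range_add, Finset.sum_range_add,
      Finset.sum_eq_zero, Finset.sum_eq_zero (s := Finset.range m), zero_add, add_zero,
      Nat.add_sub_cancel_left, add_pow, Finset.mul_sum, Finset.sum_mul, Finset.sum_mul]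
    · refine Finset.sum_congr rfl fun i hi => ?_
      have hi : i ≤ N := by simpa [Nat.lt_succ_iff] using hi
      obtain ⟨l, rfl⟩ := Nat.exists_eq_add_of_le hi
      rw [show 2 * m + (i + l) - (m + i) = m + l by omega, Nat.add_sub_cancel_left,
        show 2 * m + (i + l) = (m + i) + (m + l) by ring, Nat.cast_add_choose, Nat.cast_add_choose,
        Nat.cast_add_choose, show m + i + (m + l) = 2 * m + (i + l) by ring,
        Nat.cast_add_choose, Nat.cast_add_choose]
      have := Nat.factorial_pos
      have hf : ∀ p : ℕ, (p.factorial : ℝ) ≠ 0 := fun p => by exact_mod_cast (this p).ne'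
      field_simp [hf]
      ring
    · intro j hj
      have : j < m := by simpa using hj
      simp [Nat.choose_eq_zero_of_lt (show 2 * m + N - (m + (N + 1) + j) < m by omega)]
    · intro j hj
      have : j < m := by simpa using hj
      simp [Nat.choose_eq_zero_of_lt this]

theorem ultra_eq_sum {β : ℝ} (hβ : 0 < β) (k : ℕ) (u v : ℝ) :
    ultra β k u v = ∑ m ∈ Finset.range (k + 1),
      (k.choose (2 * m) : ℝ) * (u + v) ^ (k - 2 * m) * (4 * (u * v)) ^ m
        * (poch (1 / 2) m / poch β m) := by
  have hm : ∀ m ∈ Finset.range (k + 1),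
      (k.choose (2 * m) : ℝ) * (u + v) ^ (k - 2 * m) * (4 * (u * v)) ^ m
        * (poch (1 / 2) m / poch β m)
      = ∑ j ∈ Finset.range (k + 1), (k.choose j : ℝ) * u ^ j * v ^ (k - j)
        * ((j.choose m : ℝ) * ((k - j).choose m) * m.factorial / poch β m) := by
    intro m _
    have hf : (m.factorial : ℝ) ≠ 0 := by exact_mod_cast m.factorial_pos.ne'
    have h := sum_choose_mul_pow k m u v
    rw [← poch_one_half, mul_div_assoc, div_self hf, mul_one] at h
    rw [mul_pow, mul_div_assoc', show (k.choose (2 * m) : ℝ) * (u + v) ^ (k - 2 * m)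
      * (4 ^ m * (u * v) ^ m) * poch (1 / 2) m = (k.choose (2 * m) : ℝ) * (u + v) ^ (k - 2 * m)
      * (u * v) ^ m * (poch (1 / 2) m * 4 ^ m) by ring, ← h, Finset.sum_div]
    exact Finset.sum_congr rfl fun j _ => by ring
  rw [Finset.sum_congr rfl hm, Finset.sum_comm]
  refine Finset.sum_congr rfl fun j hj => ?_
  rw [← Finset.mul_sum, sum_choose_mul_choose_div_poch j (k - j) (k + 1) (by simpa using hj) hβ]
  have hjk : k - j + j = k := Nat.sub_add_cancel (by simpa [Nat.lt_succ_iff] using hj)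
  have hp : poch β k = poch β (k - j) * poch (β + (k - j : ℕ)) j := by rw [← poch_add, hjk]
  have h1 := (poch_pos hβ j).ne'
  have h2 := (poch_pos hβ (k - j)).ne'
  rw [hp]
  field_simp

theorem intervalIntegrable_beta {a b : ℝ} (ha : 0 < a) (hb : 0 < b) :
    IntervalIntegrable (fun t : ℝ => t ^ (a - 1) * (1 - t) ^ (b - 1)) MeasureTheory.volume 0 1 := by
  have h := Complex.betaIntegral_convergent (u := a) (v := b) (by simpa) (by simpa)
  rw [intervalIntegrable_iff_integrableOn_Ioc_of_le zero_le_one] at h ⊢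
  refine (MeasureTheory.Integrable.re h).congr ?_
  refine MeasureTheory.ae_restrict_of_forall_mem measurableSet_Ioc fun t ht => ?_
  have h1 : (0 : ℝ) ≤ 1 - t := by linarith [ht.2]
  have : (t : ℂ) ^ ((a : ℂ) - 1) * (1 - (t : ℂ)) ^ ((b : ℂ) - 1)
      = ((t ^ (a - 1) * (1 - t) ^ (b - 1) : ℝ) : ℂ) := by
    push_cast [Complex.ofReal_cpow ht.1.le, Complex.ofReal_cpow h1]
    rfl
  simp only [this]
  exact Complex.ofReal_re _

theorem betaFn_eq {a b : ℝ} (ha : 0 < a) (hb : 0 < b) :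
    betaFn a b = ProbabilityTheory.beta a b := by
  have h : Complex.betaIntegral a b = (betaFn a b : ℂ) := by
    rw [Complex.betaIntegral, betaFn, ← intervalIntegral.integral_ofReal]
    refine intervalIntegral.integral_congr fun t ht => ?_
    rw [Set.uIcc_of_le zero_le_one] at ht
    have h1 : (0 : ℝ) ≤ 1 - t := by linarith [ht.2]
    push_cast [Complex.ofReal_cpow ht.1, Complex.ofReal_cpow h1]
    rfl
  rw [ProbabilityTheory.beta_eq_betaIntegralReal a b ha hb, h, Complex.ofReal_re]

theorem betaFn_pos {a b : ℝ} (ha : 0 < a) (hb : 0 < b) : 0 < betaFn a b :=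
  betaFn_eq ha hb ▸ ProbabilityTheory.beta_pos ha hb

/-- The expectation of `g` under the beta distribution with parameters `a` and `b`. -/
def betaMean (a b : ℝ) (g : ℝ → ℝ) : ℝ :=
  (∫ t in (0 : ℝ)..1, g t * (t ^ (a - 1) * (1 - t) ^ (b - 1))) / betaFn a b

theorem betaMean_nonneg {a b : ℝ} (ha : 0 < a) (hb : 0 < b) {g : ℝ → ℝ}
    (hg : ∀ t ∈ Set.Icc (0 : ℝ) 1, 0 ≤ g t) : 0 ≤ betaMean a b g := by
  refine div_nonneg (intervalIntegral.integral_nonneg zero_le_one fun t ht => ?_)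
    (betaFn_pos ha hb).le
  have h1 : (0 : ℝ) ≤ 1 - t := by linarith [ht.2]
  exact mul_nonneg (hg t ht) (mul_nonneg (Real.rpow_nonneg ht.1 _) (Real.rpow_nonneg h1 _))

theorem betaMean_congr (a b : ℝ) {g h : ℝ → ℝ}
    (hgh : ∀ t ∈ Set.Icc (0 : ℝ) 1, g t = h t) : betaMean a b g = betaMean a b h := by
  rw [betaMean, betaMean]
  congr 1
  refine intervalIntegral.integral_congr fun t ht => ?_
  rw [Set.uIcc_of_le zero_le_one] at ht
  simp only [hgh t ht]

theorem betaMean_sum {a b : ℝ} (ha : 0 < a) (hb : 0 < b) {ι : Type*} (s : Finset ι) (c : ι → ℝ)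
    (g : ι → ℝ → ℝ) (hg : ∀ i ∈ s, ContinuousOn (g i) (Set.Icc 0 1)) :
    betaMean a b (fun t => ∑ i ∈ s, c i * g i t) = ∑ i ∈ s, c i * betaMean a b (g i) := by
  simp only [betaMean, Finset.sum_mul, mul_assoc, mul_div_assoc']
  rw [intervalIntegral.integral_finsetSum, Finset.sum_div]
  · simp only [intervalIntegral.integral_const_mul]
  · intro i hi
    refine IntervalIntegrable.const_mul ?_ _
    refine (intervalIntegrable_beta ha hb).continuousOn_mul ?_
    rw [Set.uIcc_of_le zero_le_one]
    exact hg i hi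

theorem betaMean_pow_mul_pow {a b : ℝ} (ha : 0 < a) (hb : 0 < b) (j l : ℕ) :
    betaMean a b (fun t => t ^ j * (1 - t) ^ l)
      = poch a j * poch b l / poch (a + b) (j + l) := by
  have key : ∫ t in (0 : ℝ)..1, (t ^ j * (1 - t) ^ l) * (t ^ (a - 1) * (1 - t) ^ (b - 1))
      = betaFn (a + j) (b + l) := by
    rw [betaFn]
    refine intervalIntegral.integral_congr_ae ?_
    have hne : ∀ᵐ t : ℝ, t ≠ 1 := by simp [MeasureTheory.ae_iff]
    filter_upwards [hne] with t h1 ht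
    rw [Set.uIoc_of_le zero_le_one] at ht
    have h1 : 0 < 1 - t := by
      have := lt_of_le_of_ne ht.2 h1
      linarith
    rw [show a + j - 1 = a - 1 + j by ring, show b + l - 1 = b - 1 + l by ring,
      Real.rpow_add_natCast ht.1.ne', Real.rpow_add_natCast h1.ne']
    ring
  have hG := Real.Gamma_pos_of_pos ha
  have hG' := Real.Gamma_pos_of_pos hb
  have hG'' := Real.Gamma_pos_of_pos (add_pos ha hb)
  have hp := poch_pos (add_pos ha hb) (j + l)
  rw [betaMean, key, betaFn_eq (by positivity) (by positivity), betaFn_eq ha hb,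
    ProbabilityTheory.beta, ProbabilityTheory.beta, Gamma_add_natCast ha, Gamma_add_natCast hb,
    show a + j + (b + l) = a + b + ((j + l : ℕ) : ℝ) by push_cast; ring,
    Gamma_add_natCast (add_pos ha hb)]
  field_simp

theorem betaMean_const_mul (a b c : ℝ) (g : ℝ → ℝ) :
    betaMean a b (fun t => c * g t) = c * betaMean a b g := by
  simp only [betaMean, mul_assoc, intervalIntegral.integral_const_mul, mul_div_assoc]

/-- A Laplace-type integral representation of `ultra`. -/
theorem ultra_eq_betaMean {β : ℝ} (hβ : 1 / 2 < β) (k : ℕ) {u v : ℝ} (hu : 0 ≤ u) (hv : 0 ≤ v) :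
    ultra β k u v = betaMean (1 / 2) (β - 1 / 2) (fun s =>
      ((u + v + 2 * √(u * v) * √s) ^ k + (u + v - 2 * √(u * v) * √s) ^ k) / 2) := by
  have hβ' : 0 < β - 1 / 2 := by linarith
  have hcongr : ∀ s ∈ Set.Icc (0 : ℝ) 1,
      ((u + v + 2 * √(u * v) * √s) ^ k + (u + v - 2 * √(u * v) * √s) ^ k) / 2
      = ∑ m ∈ Finset.range (k + 1),
        ((k.choose (2 * m) : ℝ) * (u + v) ^ (k - 2 * m) * (4 * (u * v)) ^ m)
          * (s ^ m * (1 - s) ^ 0) := by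
    intro s hs
    rw [half_add_pow_add_sub_pow, mul_pow, mul_pow, Real.sq_sqrt (mul_nonneg hu hv),
      Real.sq_sqrt hs.1]
    refine Finset.sum_congr rfl fun m _ => ?_
    ring
  rw [betaMean_congr _ _ hcongr, betaMean_sum (by norm_num) hβ' _ _ _ (fun m _ => by fun_prop),
    ultra_eq_sum (by linarith)]
  refine Finset.sum_congr rfl fun m _ => ?_
  rw [betaMean_pow_mul_pow (by norm_num) hβ', poch_zero, add_zero, add_sub_cancel, mul_one]

theorem sum_mul_ultra_nonneg {β : ℝ} (hβ : 1 / 2 < β) (S : Finset ℕ) (q : ℕ → ℝ)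
    (hq : ∀ z ∈ Set.Icc (0 : ℝ) 1, 0 ≤ ∑ k ∈ S, q k * z ^ k) {u v : ℝ} (hu : 0 ≤ u) (hv : 0 ≤ v)
    (huv : u + v + 2 * √(u * v) ≤ 1) : 0 ≤ ∑ k ∈ S, q k * ultra β k u v := by
  have hβ' : 0 < β - 1 / 2 := by linarith
  simp only [ultra_eq_betaMean hβ _ hu hv]
  rw [← betaMean_sum (by norm_num) hβ' _ _ _ (fun k _ => by fun_prop)]
  refine betaMean_nonneg (by norm_num) hβ' fun s hs => ?_
  have hw := Real.sqrt_nonneg (u * v)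
  have hs0 := Real.sqrt_nonneg s
  have hs1 : √s ≤ 1 := Real.sqrt_le_one.2 hs.2
  have hamgm : 2 * √(u * v) ≤ u + v := by
    rw [Real.sqrt_mul hu]
    nlinarith [sq_nonneg (√u - √v), Real.sq_sqrt hu, Real.sq_sqrt hv]
  have hws : √(u * v) * √s ≤ √(u * v) := mul_le_of_le_one_right hw hs1
  have hws0 : 0 ≤ √(u * v) * √s := mul_nonneg hw hs0
  have h1 := hq (u + v + 2 * √(u * v) * √s) ⟨by linarith, by linarith⟩
  have h2 := hq (u + v - 2 * √(u * v) * √s) ⟨by linarith, by linarith⟩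
  calc (0 : ℝ) ≤ (∑ k ∈ S, q k * (u + v + 2 * √(u * v) * √s) ^ k
      + ∑ k ∈ S, q k * (u + v - 2 * √(u * v) * √s) ^ k) / 2 := by positivity
    _ = _ := by
      rw [← Finset.sum_add_distrib, Finset.sum_div]
      exact Finset.sum_congr rfl fun k _ => by ring

theorem ip_eq_betaMean (α : ℝ) (f g : ℝ → ℝ) :
    ip α f g = betaMean (α + 1) (α + 1) (fun t => f t * g t) := by
  simp only [ip, betaMean, wght, add_sub_cancel_right, mul_div_assoc',
    intervalIntegral.integral_div]

theorem ip_bern_one {α : ℝ} (hα : -1 < α) {k j : ℕ} (hj : j ≤ k) :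
    ip α (bern k j) (fun _ => 1)
      = k.choose j * (poch (α + 1) j * poch (α + 1) (k - j) / poch (2 * α + 2) k) := by
  have hβ : 0 < α + 1 := by linarith
  have h := betaMean_pow_mul_pow hβ hβ j (k - j)
  rw [Nat.add_sub_cancel' hj, show α + 1 + (α + 1) = 2 * α + 2 by ring] at h
  rw [ip_eq_betaMean, ← h, ← betaMean_const_mul]
  simp only [bern, mul_one, mul_assoc]

/-- The normalized operator `D_k` has kernel `ultra (α + 1) k (x t) ((1 - x) (1 - t))`. -/
theorem mul_Dlup_eq {α : ℝ} (hα : -1 < α) (k : ℕ) {f : ℝ → ℝ}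
    (hf : ContinuousOn f (Set.Icc 0 1)) (x : ℝ) :
    poch (α + 1) k / poch (2 * α + 2) k * Dlup α k f x
      = betaMean (α + 1) (α + 1)
        (fun t => f t * ultra (α + 1) k (x * t) ((1 - x) * (1 - t))) := by
  have hβ : 0 < α + 1 := by linarith
  have hker : ∀ t ∈ Set.Icc (0 : ℝ) 1,
      f t * ultra (α + 1) k (x * t) ((1 - x) * (1 - t))
      = ∑ j ∈ Finset.range (k + 1),
        (poch (α + 1) k / (poch (α + 1) j * poch (α + 1) (k - j)) * (x ^ j * (1 - x) ^ (k - j)))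
          * (bern k j t * f t) := by
    intro t _
    rw [ultra, Finset.mul_sum]
    refine Finset.sum_congr rfl fun j _ => ?_
    rw [bern, mul_pow, mul_pow (1 - x)]
    ring
  rw [betaMean_congr _ _ hker, betaMean_sum hβ hβ, Dlup, Finset.mul_sum]
  · refine Finset.sum_congr rfl fun j hj => ?_
    have hj : j ≤ k := by simpa [Nat.lt_succ_iff] using hj
    rw [ip_bern_one hα hj, ip_eq_betaMean, bern]
    have hc : (k.choose j : ℝ) ≠ 0 := by exact_mod_cast (Nat.choose_pos hj).ne'
    have h1 := (poch_pos hβ j).ne'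
    have h2 := (poch_pos hβ (k - j)).ne'
    have h3 := (poch_pos (show 0 < 2 * α + 2 by linarith) k).ne'
    generalize poch (2 * α + 2) k = p at h3 ⊢
    field_simp
  · intro j _
    unfold bern
    fun_prop

theorem sum_mul_Dlup_nonneg {α : ℝ} (hα : -(1 / 2 : ℝ) < α) (S : Finset ℕ) (q : ℕ → ℝ)
    (hq : ∀ z ∈ Set.Icc (0 : ℝ) 1, 0 ≤ ∑ k ∈ S, q k * z ^ k) {f : ℝ → ℝ}
    (hf : ContinuousOn f (Set.Icc 0 1)) (hf0 : ∀ t ∈ Set.Icc (0 : ℝ) 1, 0 ≤ f t)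
    {x : ℝ} (hx : x ∈ Set.Icc (0 : ℝ) 1) :
    0 ≤ ∑ k ∈ S, q k * (poch (α + 1) k / poch (2 * α + 2) k * Dlup α k f x) := by
  have hβ : 0 < α + 1 := by linarith
  have hα' : -1 < α := by linarith
  simp only [mul_Dlup_eq hα' _ hf]
  rw [← betaMean_sum hβ hβ]
  · refine betaMean_nonneg hβ hβ fun t ht => ?_
    have hx' : 0 ≤ 1 - x := sub_nonneg.2 hx.2
    have ht' : 0 ≤ 1 - t := sub_nonneg.2 ht.2
    have huv : x * t + (1 - x) * (1 - t) + 2 * √(x * t * ((1 - x) * (1 - t))) ≤ 1 := by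
      have hp : 0 ≤ x * (1 - t) := mul_nonneg hx.1 ht'
      have hr : 0 ≤ t * (1 - x) := mul_nonneg ht.1 hx'
      rw [show x * t * ((1 - x) * (1 - t)) = x * (1 - t) * (t * (1 - x)) by ring,
        Real.sqrt_mul hp]
      nlinarith [sq_nonneg (√(x * (1 - t)) - √(t * (1 - x))), Real.sq_sqrt hp, Real.sq_sqrt hr]
    have h := mul_nonneg (hf0 t ht) (sum_mul_ultra_nonneg (show 1 / 2 < α + 1 by linarith) S q hq
      (mul_nonneg hx.1 ht.1) (mul_nonneg hx' ht') huv)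
    rw [Finset.mul_sum] at h
    simpa only [mul_left_comm] using h
  · intro k _
    unfold ultra
    fun_prop

theorem iteratedDeriv_polynomial_eval (P : Polynomial ℝ) (r : ℕ) :
    iteratedDeriv r (fun y => P.eval y) = fun y => (Polynomial.derivative^[r] P).eval y := by
  induction r with
  | zero => simp
  | succ r ih =>
    rw [iteratedDeriv_succ, ih, Function.iterate_succ_apply']
    funext y
    exact Polynomial.deriv _

theorem pow_mul_iteratedDeriv_eval_eq_sum {n r ρ : ℕ} (hρr : ρ ≤ r) (hrn : r ≤ n)
    {P : Polynomial ℝ} (hdeg : P.natDegree ≤ n) (s : ℝ) :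
    s ^ (r - ρ) * iteratedDeriv r (fun y => P.eval y) s
      = ∑ k ∈ Finset.Icc (r - ρ) (n - ρ),
        poch ((k : ℝ) - r + ρ + 1) r * P.coeff (k + ρ) * s ^ k := by
  have hlt : (Polynomial.derivative^[r] P).natDegree < n - r + 1 := by
    have := Polynomial.natDegree_iterate_derivative P r
    omega
  rw [iteratedDeriv_polynomial_eval, ← Finset.Ico_add_one_right_eq_Icc, Finset.sum_Ico_eq_sum_range,
    show n - ρ + 1 - (r - ρ) = n - r + 1 by omega]
  beta_reduce
  rw [Polynomial.eval_eq_sum_range' hlt, Finset.mul_sum]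
  refine Finset.sum_congr rfl fun m _ => ?_
  have hcast : ((r - ρ + m : ℕ) : ℝ) - r + ρ + 1 = m + 1 := by
    push_cast [Nat.cast_sub hρr]
    ring
  rw [Polynomial.coeff_iterate_derivative, hcast, poch_natCast_add_one,
    show r - ρ + m + ρ = m + r by omega, nsmul_eq_mul, pow_add]
  ring

theorem statement17 (α : ℝ) (hα : -(1 / 2 : ℝ) < α) (n r ρ : ℕ)
    (hρr : ρ ≤ r) (hrn : r ≤ n)
    (P : Polynomial ℝ) (hdeg : P.natDegree ≤ n)
    (hP : ∀ x ∈ I01, 0 ≤ iteratedDeriv r (fun y => P.eval y) x)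
    (a b : ℝ) (ha : 0 ≤ a) (hab : a ≤ b) (hb : b ≤ 1)
    (σ : ℝ → ℝ) (hσ : ∀ x ∈ Set.Icc a b, σ x ∈ I01) :
    ∀ f, ContinuousOn f I01 → (∀ t ∈ I01, 0 ≤ f t) →
      ∀ x ∈ Set.Icc a b,
        0 ≤ ∑ k ∈ Finset.Icc (r - ρ) (n - ρ),
          poch (α + 1) k * poch ((k : ℝ) - (r : ℝ) + (ρ : ℝ) + 1) r / poch (2 * α + 2) k *
            P.coeff (k + ρ) * σ x ^ k * Dlup α k f x := by
  intro f hf hf0 x hx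
  have hσx := hσ x hx
  have hq : ∀ z ∈ Set.Icc (0 : ℝ) 1, 0 ≤ ∑ k ∈ Finset.Icc (r - ρ) (n - ρ),
      (poch ((k : ℝ) - r + ρ + 1) r * P.coeff (k + ρ) * σ x ^ k) * z ^ k := by
    intro z hz
    have hmem : σ x * z ∈ I01 :=
      ⟨mul_nonneg hσx.1 hz.1, mul_le_one₀ hσx.2 hz.1 hz.2⟩
    have h := mul_nonneg (pow_nonneg hmem.1 (r - ρ)) (hP _ hmem)
    rw [pow_mul_iteratedDeriv_eval_eq_sum hρr hrn hdeg] at h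
    simpa only [mul_pow, mul_assoc] using h
  refine (sum_mul_Dlup_nonneg hα _ _ hq hf hf0
    ⟨ha.trans hx.1, hx.2.trans hb⟩).trans_eq (Finset.sum_congr rfl fun k _ => ?_)
  ring
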